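/- Fix an integer N ≥ 1. Let H be a real symmetric positive definite (2N)×(2N) matrix with smallest eigenvalue μ > 0, written in N×N blocks as H = [[P, Mᵀ],[M, Q]], and define D* := (1/2)P, A* := (1/(8π²))Q and B* := (1/(2πi))M. Let c* ∈ ℂ with Re(c*) = 0. Then there exists a constant C > 0, depending only on N and μ, with the following property: if φ : ℝ^N → ℂ is a Schwartz function and f : ℝ^N → ℂ satisfies −div(A*∇φ)(z) + div(φ B*z)(z) + c*φ(z) + (D*z·z)φ(z) = f(z) for all z ∈ ℝ^N, then ∫_{ℝ^N}(|φ|² + |∇φ|² + |z|²|φ|²) dz ≤ C ∫_{ℝ^N}|f|² dz. -/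

import Mathlib

open MeasureTheory Real ComplexConjugate
open scoped LineDeriv

lemma ape_inner (a b : ℂ) : inner ℝ a b = a.re * b.re + a.im * b.im := by
  rw [Complex.inner]; simp; ring

lemma ape_B (m t : ℝ) (w : ℂ) :
    ((1 / (2 * (π : ℂ) * Complex.I)) * (m : ℂ) * (t : ℂ)) * w
      = ((m * t * w.im / (2 * π) : ℝ) : ℂ) - ((m * t * w.re / (2 * π) : ℝ) : ℂ) * Complex.I := by
  have hp : (π : ℂ) ≠ 0 := by exact_mod_cast Real.pi_ne_zero
  have : w = (w.re : ℂ) + w.im * Complex.I := (Complex.re_add_im w).symm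
  conv_lhs => rw [this]
  push_cast
  field_simp
  ring_nf
  simp only [Complex.I_sq]
  ring

lemma ape_B' (m t : ℝ) (w : ℂ) :
    ((1 / (2 * (π : ℂ) * Complex.I)) * (m : ℂ) * (t : ℂ)) * w
      = ⟨m * t * w.im / (2 * π), - (m * t * w.re / (2 * π))⟩ := by
  rw [ape_B]
  apply Complex.ext
  · simp only [Complex.sub_re, Complex.re_ofReal_mul, Complex.ofReal_re, Complex.I_re]; ring
  · simp only [Complex.sub_im, Complex.im_ofReal_mul, Complex.ofReal_im, Complex.I_im]; ring

/-- the pointwise positivity -/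
lemma ape_pointwise (N : ℕ) (μ : ℝ) (hμ : 0 < μ) (P M Q : Matrix (Fin N) (Fin N) ℝ)
    (hH : ∀ v : Fin N ⊕ Fin N → ℝ,
          μ * ∑ p : Fin N ⊕ Fin N, v p ^ 2 ≤
            ∑ p : Fin N ⊕ Fin N, ∑ q : Fin N ⊕ Fin N,
              Matrix.fromBlocks P M.transpose M Q p q * v q * v p)
    (c : ℂ) (hc : c.re = 0) (z : Fin N → ℝ) (u : ℂ) (p : Fin N → ℂ) :
    μ / (8 * π ^ 2) * ((∑ j, ‖p j‖ ^ 2) + (∑ j, z j ^ 2) * ‖u‖ ^ 2) ≤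
      (∑ k, ∑ l, (1 / (8 * π ^ 2) * Q k l) * inner ℝ (p k) (p l))
      + inner ℝ u (((∑ k : Fin N, (∑ l : Fin N,
                (1 / (2 * (π : ℂ) * Complex.I)) * (M k l : ℂ) * (z l : ℂ))
                  * p k)
             + (∑ k : Fin N, (1 / (2 * (π : ℂ) * Complex.I)) * (M k k : ℂ)) * u)
          + c * u
          + ((∑ h : Fin N, ∑ l : Fin N, (1 / 2 : ℝ) * P h l * z l * z h : ℝ) : ℂ) * u) := by
  have hpi := Real.pi_pos
  have h1 := hH (Sum.elim (fun j => z j * u.re) (fun j => (p j).im / (2 * π)))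
  have h2 := hH (Sum.elim (fun j => z j * u.im) (fun j => - (p j).re / (2 * π)))
  simp only [Fintype.sum_sum_type, Sum.elim_inl, Sum.elim_inr, Matrix.fromBlocks_apply₁₁,
    Matrix.fromBlocks_apply₁₂, Matrix.fromBlocks_apply₂₁, Matrix.fromBlocks_apply₂₂,
    Matrix.transpose_apply, Finset.sum_add_distrib] at h1 h2
  have hl : (∑ j, ((p j).im / (2 * π)) ^ 2) + (∑ j, (- (p j).re / (2 * π)) ^ 2)
      = 1 / (4 * π ^ 2) * ∑ j, ‖p j‖ ^ 2 := by
    rw [Finset.mul_sum, ← Finset.sum_add_distrib]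
    refine Finset.sum_congr rfl fun j _ => ?_
    rw [← Complex.normSq_eq_norm_sq, Complex.normSq_apply]
    field_simp; ring
  have hz : (∑ j, (z j * u.re) ^ 2) + (∑ j, (z j * u.im) ^ 2) = (∑ j, z j ^ 2) * ‖u‖ ^ 2 := by
    rw [Finset.sum_mul, ← Finset.sum_add_distrib]
    refine Finset.sum_congr rfl fun j _ => ?_
    rw [← Complex.normSq_eq_norm_sq, Complex.normSq_apply]
    ring
  have hM1 : ∀ (s : ℝ) (w : Fin N → ℝ), (∑ x, ∑ y, M y x * w y * (z x * s))
      = ∑ k, ∑ l, M k l * (z l * s) * w k := by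
    intro s w
    rw [Finset.sum_comm]
    refine Finset.sum_congr rfl fun j _ => Finset.sum_congr rfl fun i _ => ?_
    ring
  rw [hM1] at h1 h2
  have hB : inner ℝ u (∑ k : Fin N, (∑ l : Fin N,
                (1 / (2 * (π : ℂ) * Complex.I)) * (M k l : ℂ) * (z l : ℂ)) * p k)
      = (∑ k, ∑ l, M k l * (z l * u.re) * ((p k).im / (2 * π)))
        + ∑ k, ∑ l, M k l * (z l * u.im) * (- (p k).re / (2 * π)) := by
    simp only [Finset.sum_mul, inner_sum, ← Finset.sum_add_distrib]
    refine Finset.sum_congr rfl fun j _ => Finset.sum_congr rfl fun i _ => ?_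
    rw [ape_B', ape_inner]
    ring
  have hT : inner ℝ u ((∑ k : Fin N, (1 / (2 * (π : ℂ) * Complex.I)) * (M k k : ℂ)) * u) = 0 := by
    simp only [Finset.sum_mul, inner_sum]
    refine Finset.sum_eq_zero fun k _ => ?_
    have := ape_B' (M k k) 1 u
    rw [Complex.ofReal_one, mul_one] at this
    rw [this, ape_inner]
    ring
  have hC : inner ℝ u (c * u) = 0 := by
    rw [ape_inner]; simp [hc]; ring
  have hP : inner ℝ u (((∑ h : Fin N, ∑ l : Fin N, (1 / 2 : ℝ) * P h l * z l * z h : ℝ) : ℂ) * u)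
      = 1 / 2 * ((∑ x, ∑ y, P x y * (z y * u.re) * (z x * u.re))
        + ∑ x, ∑ y, P x y * (z y * u.im) * (z x * u.im)) := by
    rw [ape_inner, Complex.re_ofReal_mul, Complex.im_ofReal_mul]
    simp only [Finset.mul_sum, Finset.sum_mul, ← Finset.sum_add_distrib]
    refine Finset.sum_congr rfl fun j _ => Finset.sum_congr rfl fun i _ => ?_
    ring
  have hQ : (∑ k, ∑ l, (1 / (8 * π ^ 2) * Q k l) * inner ℝ (p k) (p l))
      = 1 / 2 * ((∑ x, ∑ y, Q x y * ((p y).im / (2 * π)) * ((p x).im / (2 * π)))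
        + ∑ x, ∑ y, Q x y * (-(p y).re / (2 * π)) * (-(p x).re / (2 * π))) := by
    simp only [Finset.mul_sum, ← Finset.sum_add_distrib]
    refine Finset.sum_congr rfl fun j _ => Finset.sum_congr rfl fun i _ => ?_
    rw [ape_inner]
    field_simp
    ring
  rw [inner_add_right, inner_add_right, inner_add_right, hB, hT, hC, hP, hQ]
  have hzn : 0 ≤ (∑ j, z j ^ 2) * ‖u‖ ^ 2 :=
    mul_nonneg (Finset.sum_nonneg fun _ _ => sq_nonneg _) (sq_nonneg _)
  have hbig : μ / (8 * π ^ 2) * ((∑ j, z j ^ 2) * ‖u‖ ^ 2)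
      ≤ μ / 2 * ((∑ j, z j ^ 2) * ‖u‖ ^ 2) := by
    refine mul_le_mul_of_nonneg_right ?_ hzn
    apply div_le_div_of_nonneg_left hμ.le (by norm_num)
    nlinarith [Real.pi_gt_three]
  have hpp : μ / (8 * π ^ 2) * (∑ j, ‖p j‖ ^ 2)
      = μ / 2 * (1 / (4 * π ^ 2) * ∑ j, ‖p j‖ ^ 2) := by
    field_simp; ring
  rw [mul_add, hpp, ← hl]
  rw [← hz] at hbig ⊢
  linarith

section
variable {N : ℕ}

lemma ape_integrable (F G : SchwartzMap (EuclideanSpace ℝ (Fin N)) ℂ) :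
    Integrable (fun z => inner ℝ (F z) (G z)) :=
  (SchwartzMap.pairing (innerSL ℝ) F G).integrable

lemma ape_ibp (F G : SchwartzMap (EuclideanSpace ℝ (Fin N)) ℂ) (v : (EuclideanSpace ℝ (Fin N))) :
    ∫ z, (inner ℝ (F z) ((∂_{v} G) z) + inner ℝ ((∂_{v} F) z) (G z)) = 0 := by
  rw [integral_add (ape_integrable _ _) (ape_integrable _ _)]
  have : ∫ z, inner ℝ (F z) ((∂_{v} G) z) = - ∫ z, inner ℝ ((∂_{v} F) z) (G z) :=
    SchwartzMap.integral_bilinear_lineDerivOp_right_eq_neg_left (μ := volume) F G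
      (innerSL ℝ) v
  rw [this]; ring

lemma ape_sq (F : SchwartzMap (EuclideanSpace ℝ (Fin N)) ℂ) : Integrable (fun z => ‖F z‖ ^ 2) := by
  simpa using ape_integrable F F

noncomputable def apeX (l : Fin N) (F : SchwartzMap (EuclideanSpace ℝ (Fin N)) ℂ) : SchwartzMap (EuclideanSpace ℝ (Fin N)) ℂ :=
  SchwartzMap.smulLeftCLM ℂ (fun z : (EuclideanSpace ℝ (Fin N)) => z l) F

lemma ape_tg (l : Fin N) : (fun z : (EuclideanSpace ℝ (Fin N)) => z l).HasTemperateGrowth :=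
  (EuclideanSpace.proj (𝕜 := ℝ) l : (EuclideanSpace ℝ (Fin N)) →L[ℝ] ℝ).hasTemperateGrowth

lemma apeX_apply (l : Fin N) (F : SchwartzMap (EuclideanSpace ℝ (Fin N)) ℂ) (z : (EuclideanSpace ℝ (Fin N))) :
    apeX l F z = (z l : ℂ) * F z := by
  simp [apeX, SchwartzMap.smulLeftCLM_apply_apply (ape_tg l)]

lemma ape_dX (l : Fin N) (F : SchwartzMap (EuclideanSpace ℝ (Fin N)) ℂ) (z : (EuclideanSpace ℝ (Fin N))) :
    (∂_{(EuclideanSpace.single l 1 : (EuclideanSpace ℝ (Fin N)))} (apeX l F)) z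
      = F z + (z l : ℂ) * (∂_{(EuclideanSpace.single l 1 : (EuclideanSpace ℝ (Fin N)))} F) z := by
  rw [SchwartzMap.lineDerivOp_apply_eq_fderiv, SchwartzMap.lineDerivOp_apply_eq_fderiv]
  have h : (apeX l F : (EuclideanSpace ℝ (Fin N)) → ℂ) = fun z => ((EuclideanSpace.proj (𝕜 := ℝ) l : (EuclideanSpace ℝ (Fin N)) →L[ℝ] ℝ) z) • F z := by
    ext z; simp [apeX_apply]
  rw [h, fderiv_fun_smul (by fun_prop) (F.differentiableAt), ContinuousLinearMap.fderiv]
  simp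
  ring
end

theorem a_priori_estimate_homogenized_operator
    (N : ℕ) (hN : 1 ≤ N) (μ : ℝ) (hμ : 0 < μ) :
    ∃ C : ℝ, 0 < C ∧
      ∀ (P M Q : Matrix (Fin N) (Fin N) ℝ)
        (H : Matrix (Fin N ⊕ Fin N) (Fin N ⊕ Fin N) ℝ),
        H = Matrix.fromBlocks P M.transpose M Q →
        H.IsSymm →
        (∀ v : Fin N ⊕ Fin N → ℝ,
          μ * ∑ p : Fin N ⊕ Fin N, v p ^ 2 ≤
            ∑ p : Fin N ⊕ Fin N, ∑ q : Fin N ⊕ Fin N, H p q * v q * v p) →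
        ∀ (cstar : ℂ), cstar.re = 0 →
        ∀ (φ : SchwartzMap (EuclideanSpace ℝ (Fin N)) ℂ)
          (f : EuclideanSpace ℝ (Fin N) → ℂ),
        (∀ z : EuclideanSpace ℝ (Fin N),
          (- ∑ k : Fin N, fderiv ℝ
              (fun w => ∑ l : Fin N, ((1 / (8 * π ^ 2) * Q k l : ℝ) : ℂ)
                  * fderiv ℝ (⇑φ) w (EuclideanSpace.single l 1))
              z (EuclideanSpace.single k 1))
          + ((∑ k : Fin N, (∑ l : Fin N,
                (1 / (2 * (π : ℂ) * Complex.I)) * (M k l : ℂ) * (z l : ℂ))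
                  * fderiv ℝ (⇑φ) z (EuclideanSpace.single k 1))
             + (∑ k : Fin N, (1 / (2 * (π : ℂ) * Complex.I)) * (M k k : ℂ)) * φ z)
          + cstar * φ z
          + ((∑ h : Fin N, ∑ l : Fin N, (1 / 2 : ℝ) * P h l * z l * z h : ℝ) : ℂ) * φ z
          = f z) →
        (∫ z : EuclideanSpace ℝ (Fin N),
            (‖φ z‖ ^ 2
              + (∑ j : Fin N, ‖fderiv ℝ (⇑φ) z (EuclideanSpace.single j 1)‖ ^ 2)
              + ‖z‖ ^ 2 * ‖φ z‖ ^ 2)) ≤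
          C * ∫ z : EuclideanSpace ℝ (Fin N), ‖f z‖ ^ 2 := by
  have hpi := Real.pi_pos
  set m : ℝ := μ / (8 * π ^ 2) with hm
  have hmpos : 0 < m := by positivity
  refine ⟨4 / m ^ 2, by positivity, ?_⟩
  intro P M Q H hHdef _ hH c hc φ f hf
  subst hHdef
  set d : Fin N → SchwartzMap (EuclideanSpace ℝ (Fin N)) ℂ → SchwartzMap (EuclideanSpace ℝ (Fin N)) ℂ :=
    fun k F => ∂_{(EuclideanSpace.single k 1 : EuclideanSpace ℝ (Fin N))} F with hd
  have hdap : ∀ k F z, d k F z = fderiv ℝ (⇑F) z (EuclideanSpace.single k 1) :=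
    fun k F z => SchwartzMap.lineDerivOp_apply_eq_fderiv _ _ _
  -- rewrite the equation
  have hf' : ∀ z : EuclideanSpace ℝ (Fin N), f z =
      (- ∑ k, ∑ l, ((1 / (8 * π ^ 2) * Q k l : ℝ) : ℂ) * d k (d l φ) z)
      + (((∑ k : Fin N, (∑ l : Fin N,
                (1 / (2 * (π : ℂ) * Complex.I)) * (M k l : ℂ) * (z l : ℂ))
                  * d k φ z)
             + (∑ k : Fin N, (1 / (2 * (π : ℂ) * Complex.I)) * (M k k : ℂ)) * φ z)
          + c * φ z
          + ((∑ h : Fin N, ∑ l : Fin N, (1 / 2 : ℝ) * P h l * z l * z h : ℝ) : ℂ) * φ z) := by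
    intro z
    rw [← hf z]
    have h1 : ∀ k : Fin N, fderiv ℝ
              (fun w => ∑ l : Fin N, ((1 / (8 * π ^ 2) * Q k l : ℝ) : ℂ)
                  * fderiv ℝ (⇑φ) w (EuclideanSpace.single l 1))
              z (EuclideanSpace.single k 1)
        = ∑ l, ((1 / (8 * π ^ 2) * Q k l : ℝ) : ℂ) * d k (d l φ) z := by
      intro k
      have e : (fun w => ∑ l : Fin N, ((1 / (8 * π ^ 2) * Q k l : ℝ) : ℂ)
                  * fderiv ℝ (⇑φ) w (EuclideanSpace.single l 1))
          = fun w => ∑ l : Fin N, ((1 / (8 * π ^ 2) * Q k l : ℝ) : ℂ) * d l φ w := by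
        funext w
        simp only [hdap]
      rw [e, fderiv_fun_sum (fun l _ => (d l φ).differentiableAt.const_mul _)]
      rw [_root_.sum_apply]
      refine Finset.sum_congr rfl fun l _ => ?_
      rw [fderiv_const_mul (d l φ).differentiableAt, hdap k (d l φ)]
      simp
    simp only [h1]
    simp only [← hdap]
    ring
  -- `f` is a Schwartz function
  obtain ⟨F, hF⟩ : ∃ F : SchwartzMap (EuclideanSpace ℝ (Fin N)) ℂ, ∀ z, F z = f z := by
    refine ⟨(- ∑ k, ∑ l, ((1 / (8 * π ^ 2) * Q k l : ℝ) : ℂ) • d k (d l φ))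
      + (((∑ k : Fin N, ∑ l : Fin N,
                ((1 / (2 * (π : ℂ) * Complex.I)) * (M k l : ℂ)) • apeX l (d k φ))
             + (∑ k : Fin N, (1 / (2 * (π : ℂ) * Complex.I)) * (M k k : ℂ)) • φ)
          + c • φ
          + ∑ h : Fin N, ∑ l : Fin N, (((1 / 2 : ℝ) * P h l : ℝ) : ℂ) • apeX l (apeX h φ)), ?_⟩
    intro z
    rw [hf' z]
    simp only [_root_.add_apply, _root_.neg_apply, _root_.sum_apply,
      _root_.smul_apply, apeX_apply, smul_eq_mul, Finset.sum_mul, Complex.ofReal_sum,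
      Complex.ofReal_mul, mul_assoc]
  have hFi : Integrable (fun z => ‖f z‖ ^ 2) := by
    simpa only [hF] using ape_sq F
  have hφi := ape_sq φ
  set e : EuclideanSpace ℝ (Fin N) → ℝ :=
    fun z => (∑ j, ‖d j φ z‖ ^ 2) + (∑ j, z j ^ 2) * ‖φ z‖ ^ 2 with he
  have hei : Integrable e := by
    refine (integrable_finsetSum _ fun j _ => ape_sq (d j φ)).add ?_
    have := integrable_finsetSum (μ := volume) Finset.univ fun j _ => ape_sq (apeX j φ)
    refine this.congr (Filter.Eventually.of_forall fun z => ?_)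
    simp only [apeX_apply, norm_mul, mul_pow, Finset.sum_mul, Complex.norm_real, norm_eq_abs,
      sq_abs]
  -- first null term
  set G : EuclideanSpace ℝ (Fin N) → ℝ := fun z => ∑ k, ∑ l, (1 / (8 * π ^ 2) * Q k l) *
    (inner ℝ (φ z) (d k (d l φ) z) + inner ℝ (d k φ z) (d l φ z)) with hG
  have hGi1 : ∀ k l, Integrable (fun z => (1 / (8 * π ^ 2) * Q k l) *
    (inner ℝ (φ z) (d k (d l φ) z) + inner ℝ (d k φ z) (d l φ z))) := fun k l =>
    ((ape_integrable _ _).add (ape_integrable _ _)).const_mul _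
  have hGi : Integrable G :=
    integrable_finsetSum _ fun k _ => integrable_finsetSum _ fun l _ => hGi1 k l
  have hG0 : ∫ z, G z = 0 := by
    rw [hG, integral_finsetSum _ fun k _ => integrable_finsetSum _ fun l _ => hGi1 k l]
    refine Finset.sum_eq_zero fun k _ => ?_
    rw [integral_finsetSum _ fun l _ => hGi1 k l]
    refine Finset.sum_eq_zero fun l _ => ?_
    rw [integral_const_mul, ape_ibp φ (d l φ), mul_zero]
  -- second null term
  let i0 : Fin N := ⟨0, hN⟩
  set K : EuclideanSpace ℝ (Fin N) → ℝ := fun z =>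
    inner ℝ (apeX i0 φ z) (d i0 φ z) + inner ℝ (d i0 (apeX i0 φ) z) (φ z) with hK
  have hKi : Integrable K := (ape_integrable _ _).add (ape_integrable _ _)
  have hK0 : ∫ z, K z = 0 := ape_ibp _ _ _
  have hA : ∀ z, m * e z ≤ (1 / m) * ‖f z‖ ^ 2 + (m / 4) * ‖φ z‖ ^ 2 + G z := by
    intro z
    have h1 := ape_pointwise N μ hμ P M Q hH c hc (fun j => z j) (φ z) (fun j => d j φ z)
    have h2 : inner ℝ (φ z) (f z) ≤ (1 / m) * ‖f z‖ ^ 2 + (m / 4) * ‖φ z‖ ^ 2 := by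
      refine (real_inner_le_norm _ _).trans ?_
      have : (1 / m) * ‖f z‖ ^ 2 + (m / 4) * ‖φ z‖ ^ 2 - ‖φ z‖ * ‖f z‖
          = (1 / m) * (‖f z‖ - m / 2 * ‖φ z‖) ^ 2 := by
        field_simp; ring
      have h3 : 0 ≤ (1 / m) * (‖f z‖ - m / 2 * ‖φ z‖) ^ 2 := by positivity
      linarith
    rw [hf' z, inner_add_right, inner_neg_right] at h2
    have h4 : inner ℝ (φ z) (∑ k, ∑ l, ((1 / (8 * π ^ 2) * Q k l : ℝ) : ℂ) * d k (d l φ) z)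
        = ∑ k, ∑ l, (1 / (8 * π ^ 2) * Q k l) * inner ℝ (φ z) (d k (d l φ) z) := by
      simp only [inner_sum]
      refine Finset.sum_congr rfl fun k _ => Finset.sum_congr rfl fun l _ => ?_
      rw [← Complex.real_smul, inner_smul_right]
    have h5 : G z = (∑ k, ∑ l, (1 / (8 * π ^ 2) * Q k l) * inner ℝ (φ z) (d k (d l φ) z))
        + ∑ k, ∑ l, (1 / (8 * π ^ 2) * Q k l) * inner ℝ (d k φ z) (d l φ z) := by
      simp only [hG, mul_add, Finset.sum_add_distrib]
    rw [h4, ← hf' z] at h2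
    rw [h5]
    linarith
  have hB : ∀ z, ‖φ z‖ ^ 2 ≤ e z + K z := by
    intro z
    have h1 : K z = ‖φ z‖ ^ 2 + 2 * (z i0 * inner ℝ (φ z) (d i0 φ z)) := by
      have : d i0 (apeX i0 φ) z = φ z + (z i0 : ℂ) * d i0 φ z := ape_dX i0 φ z
      simp only [hK, this, apeX_apply, ← Complex.normSq_eq_norm_sq, Complex.normSq_apply,
        ape_inner, Complex.add_re, Complex.add_im, Complex.re_ofReal_mul, Complex.im_ofReal_mul]
      ring
    have h2 : ‖d i0 φ z‖ ^ 2 ≤ ∑ j, ‖d j φ z‖ ^ 2 :=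
      Finset.single_le_sum (f := fun j => ‖d j φ z‖ ^ 2) (fun _ _ => sq_nonneg _)
        (Finset.mem_univ i0)
    have h3 : z i0 ^ 2 ≤ ∑ j, z j ^ 2 :=
      Finset.single_le_sum (f := fun j => z j ^ 2) (fun _ _ => sq_nonneg _)
        (Finset.mem_univ i0)
    have h4 := mul_le_mul_of_nonneg_right h3 (sq_nonneg ‖φ z‖)
    have h5 : 0 ≤ ‖(z i0 : ℂ) * φ z + d i0 φ z‖ ^ 2 := sq_nonneg _
    have h6 : ‖(z i0 : ℂ) * φ z + d i0 φ z‖ ^ 2 = z i0 ^ 2 * ‖φ z‖ ^ 2 + ‖d i0 φ z‖ ^ 2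
        + 2 * (z i0 * inner ℝ (φ z) (d i0 φ z)) := by
      simp only [← Complex.normSq_eq_norm_sq, Complex.normSq_apply,
        ape_inner, Complex.add_re, Complex.add_im, Complex.re_ofReal_mul, Complex.im_ofReal_mul]
      ring
    simp only [he]
    linarith
  have hA' : m * ∫ z, e z ≤ (1 / m) * (∫ z, ‖f z‖ ^ 2) + (m / 4) * ∫ z, ‖φ z‖ ^ 2 := by
    have := integral_mono (hei.const_mul m)
      (((hFi.const_mul (1 / m)).add (hφi.const_mul (m / 4))).add hGi) hA
    rw [integral_const_mul] at this
    refine this.trans (le_of_eq ?_)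
    rw [integral_add' ((hFi.const_mul (1 / m)).add (hφi.const_mul (m / 4))) hGi,
      integral_add' (hFi.const_mul (1 / m)) (hφi.const_mul (m / 4)), hG0, integral_const_mul,
      integral_const_mul, add_zero]
  have hB' : ∫ z, ‖φ z‖ ^ 2 ≤ ∫ z, e z := by
    have := integral_mono hφi (hei.add hKi) hB
    rwa [integral_add' hei hKi, hK0, add_zero] at this
  have hL : (∫ z : EuclideanSpace ℝ (Fin N),
            (‖φ z‖ ^ 2
              + (∑ j : Fin N, ‖fderiv ℝ (⇑φ) z (EuclideanSpace.single j 1)‖ ^ 2)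
              + ‖z‖ ^ 2 * ‖φ z‖ ^ 2)) = (∫ z, ‖φ z‖ ^ 2) + ∫ z, e z := by
    rw [← integral_add hφi hei]
    refine integral_congr_ae (Filter.Eventually.of_forall fun z => ?_)
    simp only [he, ← hdap, EuclideanSpace.real_norm_sq_eq]
    ring
  rw [hL]
  have hf0 : 0 ≤ ∫ z, ‖f z‖ ^ 2 := integral_nonneg fun z => sq_nonneg _
  generalize (∫ z, ‖f z‖ ^ 2) = If at *
  generalize (∫ z, ‖φ z‖ ^ 2) = Ip at *
  generalize (∫ z, e z) = Ie at *
  have h1 : (3 / 4 * m) * Ie ≤ (1 / m) * If := by nlinarith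
  rw [div_mul_eq_mul_div, le_div_iff₀ (by positivity)]
  have h2 : 3 / 4 * m ^ 2 * Ie ≤ If := by
    have := mul_le_mul_of_nonneg_left h1 hmpos.le
    have e1 : m * ((1 / m) * If) = If := by field_simp
    rw [e1] at this
    linarith
  nlinarith [sq_nonneg m, mul_le_mul_of_nonneg_right hB' (sq_nonneg m)]
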